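/- arXiv:2309.02891 — 7 statements merged into one kernel-verified Lean document; each statement's English description precedes it below -/
import Mathlib

section
/- Let v₀, v₁, …, v_m form a hypercomplex basis of their real span M ⊆ A. Then M is contained in the quadratic cone Q_A; explicitly, every x = Σ_{s=0}^m x_s·v_s ∈ M satisfies t(x) = (2x₀)·1 and n(x) = (Σ_{s=0}^m x_s²)·1, and if x ∉ ℝ·1 (i.e. x_s ≠ 0 for some s ≥ 1) then 4·Σ_{s=0}^m x_s² > (2x₀)². -/
/-- The quadratic cone `Q_A := ℝ·1 ∪ {x ∉ ℝ·1 : t(x) = τ·1, n(x) = ν·1, 4ν > τ²}`,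
where `t(x) = x + xᶜ` and `n(x) = x·xᶜ`. -/
def quadCone {A : Type*} [Ring A] [Algebra ℝ A] (c : A →ₗ[ℝ] A) : Set A :=
  {x : A | (∃ r : ℝ, x = algebraMap ℝ A r) ∨
    ((¬ ∃ r : ℝ, x = algebraMap ℝ A r) ∧
      ∃ τ ν : ℝ, x + c x = algebraMap ℝ A τ ∧ x * c x = algebraMap ℝ A ν ∧
        4 * ν > τ ^ 2)}

/-- The square of a real combination of pairwise anticommuting square roots of `-1`. -/
lemma sum_smul_mul_self_of_anticomm {A ι : Type*} [Ring A] [Algebra ℝ A] (w : ι → A)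
    (hsq : ∀ i, w i * w i = -1) (hanti : ∀ i j, i ≠ j → w i * w j = -(w j * w i))
    (a : ι → ℝ) (S : Finset ι) :
    (∑ i ∈ S, a i • w i) * (∑ i ∈ S, a i • w i) = -algebraMap ℝ A (∑ i ∈ S, a i ^ 2) := by
  classical
  induction S using Finset.induction_on with
  | empty => simp
  | insert i S hi ih =>
    rw [Finset.sum_insert hi, Finset.sum_insert hi]
    have hcross : (a i • w i) * (∑ j ∈ S, a j • w j) = -((∑ j ∈ S, a j • w j) * (a i • w i)) := by
      rw [Finset.mul_sum, Finset.sum_mul, ← Finset.sum_neg_distrib]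
      refine Finset.sum_congr rfl fun j hj => ?_
      rw [smul_mul_smul_comm, smul_mul_smul_comm,
        hanti i j (ne_of_mem_of_not_mem hj hi).symm, smul_neg, mul_comm]
    have hself : (a i • w i) * (a i • w i) = -algebraMap ℝ A (a i ^ 2) := by
      rw [smul_mul_smul_comm, hsq, smul_neg, Algebra.algebraMap_eq_smul_one, sq]
    rw [add_mul, mul_add, mul_add, ih, hcross, hself, map_add]
    abel

/-- If `v₀,…,v_m` is a hypercomplex basis of its span `M`, then `M` is
contained in the quadratic cone; explicitly, each `x = Σ xₛ•vₛ` satisfies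
`t(x) = (2x₀)·1`, `n(x) = (Σ xₛ²)·1`, and if `x ∉ ℝ·1` then `4·Σ xₛ² > (2x₀)²`. -/
theorem stmt1 {A : Type*} [Ring A] [Algebra ℝ A] [FiniteDimensional ℝ A]
    (c : A →ₗ[ℝ] A)
    (hc_inv : ∀ x : A, c (c x) = x)
    (hc_mul : ∀ x y : A, c (x * y) = c y * c x)
    (m : ℕ) (hm : 1 ≤ m)
    (v : Fin (m + 1) → A)
    (hv_indep : LinearIndependent ℝ v)
    (hv0 : v 0 = 1)
    (hv_conj : ∀ s : Fin (m + 1), s ≠ 0 → c (v s) = -v s)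
    (hv_norm : ∀ s : Fin (m + 1), s ≠ 0 → v s * c (v s) = 1)
    (hv_anti : ∀ s t : Fin (m + 1), s ≠ 0 → t ≠ 0 → s ≠ t →
      v s * v t = -(v t * v s))
    (xc : Fin (m + 1) → ℝ) (x : A) (hx : x = ∑ s, xc s • v s) :
    x ∈ quadCone c ∧
    x + c x = algebraMap ℝ A (2 * xc 0) ∧
    x * c x = algebraMap ℝ A (∑ s, (xc s) ^ 2) ∧
    ((∃ s : Fin (m + 1), s ≠ 0 ∧ xc s ≠ 0) →
      4 * ∑ s, (xc s) ^ 2 > (2 * xc 0) ^ 2) := by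
  have hc1 : c 1 = 1 := by
    have h := hc_mul (c 1) 1
    rwa [mul_one, hc_inv, mul_one, eq_comm] at h
  set y : A := ∑ i : Fin m, xc i.succ • v i.succ with hy
  have hxy : x = algebraMap ℝ A (xc 0) + y := by
    rw [hx, Fin.sum_univ_succ, hv0, Algebra.algebraMap_eq_smul_one]
  have hcy : c y = -y := by
    rw [hy, map_sum, ← Finset.sum_neg_distrib]
    refine Finset.sum_congr rfl fun i _ => ?_
    rw [map_smul, hv_conj _ i.succ_ne_zero, smul_neg]
  have hcx : c x = algebraMap ℝ A (xc 0) - y := by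
    rw [hxy, map_add, hcy, Algebra.algebraMap_eq_smul_one, map_smul, hc1, sub_eq_add_neg]
  have hyy : y * y = -algebraMap ℝ A (∑ i : Fin m, xc i.succ ^ 2) := by
    refine sum_smul_mul_self_of_anticomm (fun i : Fin m => v i.succ) (fun i => ?_)
      (fun i j hij => hv_anti _ _ i.succ_ne_zero j.succ_ne_zero
        fun h => hij (Fin.succ_injective m h)) (fun i => xc i.succ) Finset.univ
    have h := hv_norm _ i.succ_ne_zero
    rw [hv_conj _ i.succ_ne_zero, mul_neg] at h
    exact neg_eq_iff_eq_neg.mp h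
  have ht : x + c x = algebraMap ℝ A (2 * xc 0) := by
    rw [hcx, hxy, two_mul, map_add]
    abel
  have hn : x * c x = algebraMap ℝ A (∑ s, xc s ^ 2) := by
    rw [hcx, hxy, ← Commute.mul_self_sub_mul_self_eq (Algebra.commutes (xc 0) y), hyy,
      Fin.sum_univ_succ, map_add, map_pow, sq, sub_neg_eq_add]
  have hpos : (∃ s : Fin (m + 1), s ≠ 0 ∧ xc s ≠ 0) →
      4 * ∑ s, xc s ^ 2 > (2 * xc 0) ^ 2 := by
    rintro ⟨s, hs, hxs⟩
    obtain ⟨i, rfl⟩ := Fin.exists_succ_eq.mpr hs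
    have h : 0 < ∑ i : Fin m, xc i.succ ^ 2 :=
      Finset.sum_pos' (fun _ _ => sq_nonneg _) ⟨i, Finset.mem_univ i, by positivity⟩
    rw [Fin.sum_univ_succ]
    linarith
  refine ⟨?_, ht, hn, hpos⟩
  by_cases hreal : ∃ r : ℝ, x = algebraMap ℝ A r
  · exact Or.inl hreal
  · refine Or.inr ⟨hreal, _, _, ht, hn, hpos ?_⟩
    by_contra! hzero
    refine hreal ⟨xc 0, ?_⟩
    rw [hxy, hy, Finset.sum_eq_zero fun i _ => by rw [hzero _ i.succ_ne_zero, zero_smul], add_zero]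
end

section
/- Let v₀, v₁, …, v_m form a hypercomplex basis of their real span M ⊆ A, and set v̂ := v₁·v₂·⋯·v_m (the ordered product). Then the tuple (v₀, v₁, …, v_m, v̂) is a hypercomplex basis of its real span if and only if m ≡ 2 (mod 4). In particular, when m ≡ 2 (mod 4) the following hold: v̂ᶜ = −v̂, v̂·v̂ᶜ = 1, v_ℓ·v̂ = −v̂·v_ℓ for every ℓ ∈ {1,…,m}, and 1, v₁, …, v_m, v̂ are ℝ-linearly independent. -/
/-- `v₀,…,v_m` (indexed by `Fin (m+1)`) is a hypercomplex basis of its real span: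
`m ≥ 1`, the `vₛ` are ℝ-linearly independent, `v₀ = 1`, and for all distinct
`s,t ∈ {1,…,m}`: `vₛᶜ = −vₛ`, `vₛ·vₛᶜ = 1`, `vₛ·v_t = −v_t·vₛ`. -/
def IsHypercomplexBasis {A : Type*} [Ring A] [Algebra ℝ A] (c : A →ₗ[ℝ] A)
    {m : ℕ} (v : Fin (m + 1) → A) : Prop :=
  1 ≤ m ∧
  LinearIndependent ℝ v ∧
  v 0 = 1 ∧
  (∀ s : Fin (m + 1), s ≠ 0 → c (v s) = -v s ∧ v s * c (v s) = 1) ∧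
  (∀ s t : Fin (m + 1), s ≠ 0 → t ≠ 0 → s ≠ t → v s * v t = -(v t * v s))

section Anticommuting

variable {A : Type*} [Ring A] [Algebra ℝ A]

theorem mul_list_prod_of_anticommute (y : A) (l : List A) (h : ∀ a ∈ l, y * a = -(a * y)) :
    y * l.prod = (-1 : ℝ) ^ l.length • (l.prod * y) := by
  induction l with
  | nil => simp
  | cons a t ih =>
    have ha := h a (by simp)
    have ht := ih fun b hb => h b (by simp [hb])
    rw [List.prod_cons, ← mul_assoc, ha, neg_mul, mul_assoc, ht, List.length_cons, pow_succ]
    simp [mul_assoc]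

/-- Moving a factor of a product of pairwise anticommuting elements past the product. -/
theorem mul_list_prod_of_mem_of_pairwise_anticommute {y : A} {l : List A} (hy : y ∈ l)
    (h : l.Pairwise fun a b => a * b = -(b * a)) :
    y * l.prod = (-1 : ℝ) ^ (l.length - 1) • (l.prod * y) := by
  obtain ⟨p, q, rfl⟩ := List.append_of_mem hy
  obtain ⟨-, hq, hpq⟩ := List.pairwise_append.1 h
  have hp := mul_list_prod_of_anticommute y p fun a ha => by
    rw [hpq a ha y (by simp), neg_neg]
  have hq := mul_list_prod_of_anticommute y q (List.pairwise_cons.1 hq).1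
  have hlen : (p ++ y :: q).length - 1 = p.length + q.length := by simp
  have hsq : ((-1 : ℝ) ^ q.length) * (-1) ^ q.length = 1 := by
    rw [← mul_pow]; simp
  have hq' : q.prod * y = (-1 : ℝ) ^ q.length • (y * q.prod) := by
    rw [hq, smul_smul, hsq, one_smul]
  rw [hlen, List.prod_append, List.prod_cons, ← mul_assoc, hp, mul_assoc p.prod, mul_assoc y, hq',
    pow_add, mul_smul_comm, mul_smul_comm, smul_smul, mul_assoc _ _ ((-1 : ℝ) ^ q.length), hsq,
    mul_one, smul_mul_assoc, mul_assoc]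

variable {c : A →ₗ[ℝ] A}

theorem antiinvolution_one (hc_inv : ∀ x, c (c x) = x) (hc_mul : ∀ x y, c (x * y) = c y * c x) :
    c 1 = 1 := by
  simpa [hc_inv] using (hc_mul (c 1) 1).symm

theorem antiinvolution_list_prod (hc_one : c 1 = 1) (hc_mul : ∀ x y, c (x * y) = c y * c x)
    (l : List A) (hl : ∀ a ∈ l, c a = -a) (h : l.Pairwise fun a b => a * b = -(b * a)) :
    c l.prod = (-1 : ℝ) ^ (l.length * (l.length + 1) / 2) • l.prod := by
  induction l with
  | nil => simp [hc_one]
  | cons a t ih =>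
    obtain ⟨hat, ht⟩ := List.pairwise_cons.1 h
    have hexp : (t.length + 1) * (t.length + 1 + 1) / 2 =
        t.length * (t.length + 1) / 2 + (t.length + 1) := by
      rw [show (t.length + 1) * (t.length + 1 + 1) = t.length * (t.length + 1) +
        (t.length + 1) * 2 by ring, Nat.add_mul_div_right _ _ two_pos]
    have hsq : ((-1 : ℝ) ^ t.length) * (-1) ^ t.length = 1 := by
      rw [← mul_pow]; simp
    have hta : t.prod * a = (-1 : ℝ) ^ t.length • (a * t.prod) := by
      rw [mul_list_prod_of_anticommute a t hat, smul_smul, hsq, one_smul]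
    rw [List.prod_cons, hc_mul, hl a (by simp), ih (fun b hb => hl b (by simp [hb])) ht,
      List.length_cons, hexp, mul_neg, smul_mul_assoc, hta, smul_smul, pow_add, pow_succ _ t.length]
    simp

theorem list_prod_mul_antiinvolution (hc_one : c 1 = 1) (hc_mul : ∀ x y, c (x * y) = c y * c x)
    (l : List A) (hl : ∀ a ∈ l, a * c a = 1) : l.prod * c l.prod = 1 := by
  induction l with
  | nil => simp [hc_one]
  | cons a t ih =>
    have ht := ih fun b hb => hl b (by simp [hb])
    rw [List.prod_cons, hc_mul, mul_assoc, ← mul_assoc t.prod, ht, one_mul, hl a (by simp)]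

/-- An element of the span of a hypercomplex basis anticommuting with every imaginary unit of the
basis vanishes. -/
theorem IsHypercomplexBasis.eq_zero_of_anticommute {m : ℕ} {v : Fin (m + 1) → A}
    (hv : IsHypercomplexBasis c v) {x : A} (hx : x ∈ Submodule.span ℝ (Set.range v))
    (h : ∀ s, s ≠ 0 → v s * x = -(x * v s)) : x = 0 := by
  obtain ⟨hm, hli, h0, hunit, hanti⟩ := hv
  obtain ⟨a, rfl⟩ := (Submodule.mem_span_range_iff_exists_fun ℝ).1 hx
  have hcoeff : ∀ s, s ≠ 0 → a 0 = 0 ∧ a s = 0 := by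
    intro s hs
    have hsq : v s * v s = -1 := by
      have h1 := hunit s hs
      rw [h1.1, mul_neg] at h1
      rw [← h1.2, neg_neg]
    have hterm : ∀ t, a t • (v s * v t + v t * v s) =
        (if t = 0 then (2 * a 0) • v s else 0) + if t = s then (-2 * a s) • v 0 else 0 := by
      intro t
      by_cases ht : t = 0
      · subst ht
        simp [hs.symm, h0, ← two_smul ℝ, smul_smul, mul_comm]
      · by_cases hts : t = s
        · subst hts
          rw [hsq, h0]
          simp only [if_neg ht, if_true, zero_add]
          module
        · simp [ht, hts, hanti t s ht hs hts]
    have hsum : (2 * a 0) • v s + (-2 * a s) • v 0 = 0 := by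
      have h2 := eq_neg_iff_add_eq_zero.1 (h s hs)
      rw [Finset.mul_sum, Finset.sum_mul, ← Finset.sum_add_distrib] at h2
      simp_rw [mul_smul_comm, smul_mul_assoc, ← smul_add, hterm, Finset.sum_add_distrib] at h2
      simpa [h0] using h2
    have hpair : LinearIndependent ℝ ![v s, v 0] := by
      have hinj : Function.Injective ![s, 0] := by
        simpa [Function.Injective, Fin.forall_fin_two, eq_comm] using hs
      convert hli.comp _ hinj using 1
      ext i
      fin_cases i <;> rfl
    obtain ⟨h1, h2⟩ := LinearIndependent.pair_iff.1 hpair _ _ hsum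
    constructor <;> linarith
  have h1 : (⟨1, by omega⟩ : Fin (m + 1)) ≠ 0 := by simp [Fin.ext_iff]
  refine Finset.sum_eq_zero fun s _ => ?_
  by_cases hs : s = 0
  · rw [hs, (hcoeff _ h1).1, zero_smul]
  · rw [(hcoeff s hs).2, zero_smul]

/-- Appending a further imaginary unit to a hypercomplex basis. -/
theorem IsHypercomplexBasis.snoc_iff [Nontrivial A] {m : ℕ} {v : Fin (m + 1) → A}
    (hv : IsHypercomplexBasis c v) (x : A) :
    IsHypercomplexBasis c (Fin.snoc v x : Fin (m + 2) → A) ↔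
      c x = -x ∧ x * c x = 1 ∧ ∀ s, s ≠ 0 → v s * x = -(x * v s) := by
  constructor
  · rintro ⟨-, -, -, hunit, hanti⟩
    have hlast : Fin.last (m + 1) ≠ 0 := Fin.last_pos.ne'
    refine ⟨by simpa using (hunit _ hlast).1, by simpa using (hunit _ hlast).2, fun s hs => ?_⟩
    simpa using hanti s.castSucc (Fin.last _) (by simpa using hs) hlast s.castSucc_lt_last.ne
  · rintro ⟨hcx, hxx, hx⟩
    have hx0 : x ≠ 0 := by
      rintro rfl
      simp at hxx
    have hspan : x ∉ Submodule.span ℝ (Set.range v) := fun h =>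
      hx0 (hv.eq_zero_of_anticommute h hx)
    obtain ⟨hm, hli, h0, hunit, hanti⟩ := hv
    refine ⟨by omega, linearIndependent_finSnoc.2 ⟨hli, hspan⟩, ?_, ?_, ?_⟩
    · rw [← Fin.castSucc_zero, Fin.snoc_castSucc, h0]
    · intro s
      induction s using Fin.lastCases with
      | last => simp [hcx, ← hxx]
      | cast s => simpa using hunit s
    · intro s t
      induction s using Fin.lastCases with
      | last =>
        induction t using Fin.lastCases with
        | last => simp
        | cast t => exact fun _ ht _ => by simp [hx t (by simpa using ht)]
      | cast s =>
        induction t using Fin.lastCases with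
        | last => exact fun hs _ _ => by simpa using hx s (by simpa using hs)
        | cast t => simpa using hanti s t

end Anticommuting

/-- if `v₀,…,v_m` is a hypercomplex basis and `v̂ := v₁⋯v_m` (ordered
product), then `(v₀,…,v_m,v̂)` is a hypercomplex basis of its span iff `m ≡ 2 (mod 4)`;
in particular, when `m ≡ 2 (mod 4)`: `v̂ᶜ = −v̂`, `v̂·v̂ᶜ = 1`, `v_ℓ·v̂ = −v̂·v_ℓ` for all
`ℓ ∈ {1,…,m}`, and `1, v₁, …, v_m, v̂` are ℝ-linearly independent. -/
theorem stmt2 {A : Type*} [Ring A] [Algebra ℝ A] [FiniteDimensional ℝ A]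
    (c : A →ₗ[ℝ] A)
    (hc_inv : ∀ x : A, c (c x) = x)
    (hc_mul : ∀ x y : A, c (x * y) = c y * c x)
    (m : ℕ) (v : Fin (m + 1) → A)
    (hv : IsHypercomplexBasis c v)
    (vhat : A) (hvhat : vhat = (List.ofFn (fun s : Fin m => v s.succ)).prod)
    (w : Fin (m + 2) → A) (hw : w = Fin.snoc v vhat) :
    (IsHypercomplexBasis c w ↔ m % 4 = 2) ∧
    (m % 4 = 2 →
      c vhat = -vhat ∧
      vhat * c vhat = 1 ∧
      (∀ ℓ : Fin (m + 1), ℓ ≠ 0 → v ℓ * vhat = -(vhat * v ℓ)) ∧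
      LinearIndependent ℝ w) := by
  subst hw
  obtain ⟨hm, hli, h0, hunit, hanti⟩ := id hv
  have : Nontrivial A := ⟨⟨v 0, 0, hli.ne_zero 0⟩⟩
  have : IsAddTorsionFree A := .of_isTorsionFree ℝ A
  have hc_one := antiinvolution_one hc_inv hc_mul
  set l := List.ofFn fun s : Fin m => v s.succ with hl
  have hlen : l.length = m := by simp [hl]
  have hpair : l.Pairwise fun a b => a * b = -(b * a) :=
    List.pairwise_ofFn.2 fun i j hij =>
      hanti _ _ i.succ_ne_zero j.succ_ne_zero (by simpa using hij.ne)
  have hmem : ∀ a ∈ l, c a = -a ∧ a * c a = 1 := by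
    intro a ha
    obtain ⟨i, rfl⟩ := List.mem_ofFn.1 ha
    exact hunit _ i.succ_ne_zero
  have hconj : c vhat = (-1 : ℝ) ^ (m * (m + 1) / 2) • vhat := by
    rw [hvhat, antiinvolution_list_prod hc_one hc_mul l (fun a ha => (hmem a ha).1) hpair, hlen]
  have hnorm : vhat * c vhat = 1 := by
    rw [hvhat, list_prod_mul_antiinvolution hc_one hc_mul l fun a ha => (hmem a ha).2]
  have hcomm : ∀ s, s ≠ 0 → v s * vhat = (-1 : ℝ) ^ (m - 1) • (vhat * v s) := by
    intro s hs
    obtain ⟨i, rfl⟩ := Fin.exists_succ_eq.2 hs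
    rw [hvhat, mul_list_prod_of_mem_of_pairwise_anticommute (List.mem_ofFn.2 ⟨i, rfl⟩) hpair, hlen]
  have hvhat0 : vhat ≠ 0 := by
    intro h
    simp [h] at hnorm
  have hback : m % 4 = 2 →
      c vhat = -vhat ∧ vhat * c vhat = 1 ∧ ∀ s, s ≠ 0 → v s * vhat = -(vhat * v s) := by
    intro h
    have h1 : Odd (m * (m + 1) / 2) := by
      obtain ⟨k, rfl⟩ : ∃ k, m = 4 * k + 2 := ⟨m / 4, by omega⟩
      rw [show (4 * k + 2) * (4 * k + 2 + 1) = (2 * (4 * k ^ 2 + 5 * k + 1) + 1) * 2 by ring,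
        Nat.mul_div_cancel _ two_pos]
      exact odd_two_mul_add_one _
    have h2 : Odd (m - 1) := Nat.odd_iff.2 (by omega)
    refine ⟨by rw [hconj, h1.neg_one_pow, neg_one_smul], hnorm, fun s hs => ?_⟩
    rw [hcomm s hs, h2.neg_one_pow, neg_one_smul]
  refine ⟨⟨fun hwb => ?_, fun h => (hv.snoc_iff vhat).2 (hback h)⟩, fun h => ?_⟩
  · obtain ⟨hcx, -, hx⟩ := (hv.snoc_iff vhat).1 hwb
    have hodd : Odd (m - 1) := by
      by_contra hne
      have h1 : (⟨1, by omega⟩ : Fin (m + 1)) ≠ 0 := by simp [Fin.ext_iff]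
      have h2 := hx _ h1
      rw [hcomm _ h1, (Nat.not_odd_iff_even.1 hne).neg_one_pow, one_smul, self_eq_neg] at h2
      apply hvhat0
      have h3 := congrArg (· * c (v ⟨1, by omega⟩)) h2
      simpa [mul_assoc, (hunit _ h1).2] using h3
    by_contra hne
    have heven : Even (m * (m + 1) / 2) := by
      obtain ⟨k, rfl⟩ : ∃ k, m = 4 * k := ⟨m / 4, by rw [Nat.odd_iff] at hodd; omega⟩
      rw [show 4 * k * (4 * k + 1) = 2 * (k * (4 * k + 1)) * 2 by ring,
        Nat.mul_div_cancel _ two_pos]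
      exact even_two_mul _
    rw [hconj, heven.neg_one_pow, one_smul, self_eq_neg] at hcx
    exact hvhat0 hcx
  · obtain ⟨hcx, hxx, hx⟩ := hback h
    exact ⟨hcx, hxx, hx, ((hv.snoc_iff vhat).2 ⟨hcx, hxx, hx⟩).2.1⟩
end

section
/- The function f : ℍ → ℍ given by f(x₀+ix₁+jx₂+kx₃) := x₀ + jx₂ + kx₃ is (1,3)-regular on ℍ, but it is neither left Fueter-regular (indeed ∂_{x₀}f + i·∂_{x₁}f + j·∂_{x₂}f + k·∂_{x₃}f ≡ −1 ≠ 0) nor slice-regular. -/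
open Quaternion

noncomputable section

/-- The real quaternions. -/
abbrev H : Type := Quaternion ℝ

/-- The imaginary unit `i`. -/
def qi : H := ⟨0, 1, 0, 0⟩
/-- The imaginary unit `j`. -/
def qj : H := ⟨0, 0, 1, 0⟩
/-- The imaginary unit `k`. -/
def qk : H := ⟨0, 0, 0, 1⟩

/-- `S¹`: the circle of unit quaternions in the plane `jℝ + kℝ`. -/
def S1 : Set H := {J : H | J.re = 0 ∧ J.imI = 0 ∧ J.imJ ^ 2 + J.imK ^ 2 = 1}

/-- The subset `ℂ = ℝ + iℝ` of `ℍ` (the mirror). -/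
def Cset : Set H := {x : H | x.imJ = 0 ∧ x.imK = 0}

/-- Coordinates `(x₀,x₁,β) ↦ x₀ + i x₁ + β J` for the hyperplane `ℝ³_J`. -/
def psi (J : H) (u : ℝ × ℝ × ℝ) : H := (u.1 : H) + u.2.1 • qi + u.2.2 • J

/-- The hyperplane `ℝ³_J = Span_ℝ(1, i, J)` of `ℍ`, as the range of `psi J`. -/
def hplane (J : H) : Set H := Set.range (psi J)

/-- `f` is `J`-monogenic on the `J`-hplane of `Ω`: in the coordinates `(x₀,x₁,β)`,
the restriction of `f` to `Ω ∩ ℝ³_J` is real-differentiable and satisfies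
`∂_{x₀}f + i·∂_{x₁}f + J·∂_βf = 0`. -/
def JMonogenicOn (J : H) (f : H → H) (Ω : Set H) : Prop :=
  ∀ u : ℝ × ℝ × ℝ, psi J u ∈ Ω →
    DifferentiableAt ℝ (fun v => f (psi J v)) u ∧
    fderiv ℝ (fun v => f (psi J v)) u (1, 0, 0)
      + qi * fderiv ℝ (fun v => f (psi J v)) u (0, 1, 0)
      + J * fderiv ℝ (fun v => f (psi J v)) u (0, 0, 1) = 0

/-- `f` is `(1,3)`-regular on `Ω`: for every `J ∈ S¹`, the restriction of `f`
to `Ω ∩ ℝ³_J` is `J`-monogenic. -/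
def Regular13 (f : H → H) (Ω : Set H) : Prop :=
  ∀ J ∈ S1, JMonogenicOn J f Ω

/-- `f` is left Fueter-regular on `Ω`: it is `C¹` and belongs to the kernel of the
left Cauchy–Riemann–Fueter operator `∂_{x₀} + i·∂_{x₁} + j·∂_{x₂} + k·∂_{x₃}`. -/
def FueterRegularOn (f : H → H) (Ω : Set H) : Prop :=
  ContDiffOn ℝ 1 f Ω ∧
  ∀ x ∈ Ω,
    fderiv ℝ f x 1 + qi * fderiv ℝ f x qi + qj * fderiv ℝ f x qj
      + qk * fderiv ℝ f x qk = 0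

/-- `f` is slice-regular on `Ω`: for every quaternion `I` with `I² = −1`, the
restriction of `f` to `Ω ∩ (ℝ + Iℝ)` is real-differentiable (in the coordinates
`(α,β) ↦ α + βI`) and satisfies `∂_α g + I·∂_β g = 0`. -/
def SliceRegularOn (f : H → H) (Ω : Set H) : Prop :=
  ∀ I : H, I ^ 2 = -1 →
    ∀ p : ℝ × ℝ, ((p.1 : H) + p.2 • I) ∈ Ω →
      DifferentiableAt ℝ (fun q : ℝ × ℝ => f ((q.1 : H) + q.2 • I)) p ∧
      fderiv ℝ (fun q : ℝ × ℝ => f ((q.1 : H) + q.2 • I)) p (1, 0)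
        + I * fderiv ℝ (fun q : ℝ × ℝ => f ((q.1 : H) + q.2 • I)) p (0, 1) = 0

/-- The function `f(x₀+ix₁+jx₂+kx₃) = x₀ + jx₂ + kx₃`. -/
def f6 : H → H := fun x => (x.re : H) + x.imJ • qj + x.imK • qk

@[simp] theorem qi_re : qi.re = 0 := rfl
@[simp] theorem qi_imI : qi.imI = 1 := rfl
@[simp] theorem qi_imJ : qi.imJ = 0 := rfl
@[simp] theorem qi_imK : qi.imK = 0 := rfl
@[simp] theorem qj_re : qj.re = 0 := rfl
@[simp] theorem qj_imI : qj.imI = 0 := rfl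
@[simp] theorem qj_imJ : qj.imJ = 1 := rfl
@[simp] theorem qj_imK : qj.imK = 0 := rfl
@[simp] theorem qk_re : qk.re = 0 := rfl
@[simp] theorem qk_imI : qk.imI = 0 := rfl
@[simp] theorem qk_imJ : qk.imJ = 0 := rfl
@[simp] theorem qk_imK : qk.imK = 1 := rfl

@[simp] theorem f6_re (x : H) : (f6 x).re = x.re := by simp [f6]
@[simp] theorem f6_imI (x : H) : (f6 x).imI = 0 := by simp [f6]
@[simp] theorem f6_imJ (x : H) : (f6 x).imJ = x.imJ := by simp [f6]
@[simp] theorem f6_imK (x : H) : (f6 x).imK = x.imK := by simp [f6]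

/-- A real-linear map out of a finite-dimensional space is its own derivative. -/
theorem hasFDerivAt_of_linear {E F : Type*} [NormedAddCommGroup E] [NormedSpace ℝ E]
    [FiniteDimensional ℝ E] [NormedAddCommGroup F] [NormedSpace ℝ F] {g : E → F}
    (hg : IsLinearMap ℝ g) (x : E) :
    HasFDerivAt g (LinearMap.toContinuousLinearMap hg.mk') x :=
  (LinearMap.toContinuousLinearMap hg.mk').hasFDerivAt

/-- A real-linear map out of a finite-dimensional space is its own derivative. -/
theorem fderiv_apply_of_linear {E F : Type*} [NormedAddCommGroup E] [NormedSpace ℝ E]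
    [FiniteDimensional ℝ E] [NormedAddCommGroup F] [NormedSpace ℝ F] {g : E → F}
    (hg : IsLinearMap ℝ g) (x v : E) : fderiv ℝ g x v = g v := by
  rw [(hasFDerivAt_of_linear hg x).fderiv]
  rfl

theorem isLinearMap_f6 : IsLinearMap ℝ f6 where
  map_add x y := by ext <;> simp
  map_smul c x := by ext <;> simp

theorem isLinearMap_psi (J : H) : IsLinearMap ℝ (psi J) where
  map_add u v := by ext <;> simp [psi] <;> ring
  map_smul c u := by ext <;> simp [psi] <;> ring

theorem isLinearMap_f6_comp_psi (J : H) : IsLinearMap ℝ (fun v => f6 (psi J v)) :=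
  (isLinearMap_f6.mk'.comp (isLinearMap_psi J).mk').isLinear

theorem isLinearMap_f6_slice (I : H) :
    IsLinearMap ℝ (fun q : ℝ × ℝ => f6 ((q.1 : H) + q.2 • I)) where
  map_add u v := by ext <;> simp <;> ring
  map_smul c u := by ext <;> simp <;> ring

theorem regular13_f6 : Regular13 f6 Set.univ := by
  rintro J ⟨hre, hi, hJ⟩ u -
  have hlin := isLinearMap_f6_comp_psi J
  refine ⟨(hasFDerivAt_of_linear hlin u).differentiableAt, ?_⟩
  simp only [fderiv_apply_of_linear hlin]
  ext <;> simp [psi, hre, hi] <;> linarith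

theorem cauchyRiemannFueter_f6 (x : H) :
    fderiv ℝ f6 x 1 + qi * fderiv ℝ f6 x qi + qj * fderiv ℝ f6 x qj
      + qk * fderiv ℝ f6 x qk = -1 := by
  simp only [fderiv_apply_of_linear isLinearMap_f6]
  ext <;> simp

theorem not_fueterRegularOn_f6 : ¬ FueterRegularOn f6 Set.univ := fun h => by
  have h0 := h.2 0 (Set.mem_univ 0)
  rw [cauchyRiemannFueter_f6] at h0
  exact neg_ne_zero.mpr one_ne_zero h0

theorem not_sliceRegularOn_f6 : ¬ SliceRegularOn f6 Set.univ := fun h => by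
  have hqi : qi ^ 2 = -1 := by rw [sq]; ext <;> simp
  have h0 := (h qi hqi 0 (Set.mem_univ _)).2
  simp only [fderiv_apply_of_linear (isLinearMap_f6_slice qi)] at h0
  have hre := congrArg QuaternionAlgebra.re h0
  simp at hre

/-- `f(x) = x₀ + jx₂ + kx₃` is `(1,3)`-regular on `ℍ`, but its
Cauchy–Riemann–Fueter derivative is identically `−1`, so it is not left
Fueter-regular; nor is it slice-regular. -/
theorem stmt6 :
    Regular13 f6 Set.univ ∧
    (∀ x : H,
      fderiv ℝ f6 x 1 + qi * fderiv ℝ f6 x qi + qj * fderiv ℝ f6 x qj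
        + qk * fderiv ℝ f6 x qk = -1) ∧
    ¬ FueterRegularOn f6 Set.univ ∧
    ¬ SliceRegularOn f6 Set.univ :=
  ⟨regular13_f6, cauchyRiemannFueter_f6, not_fueterRegularOn_f6, not_sliceRegularOn_f6⟩
end
end

section
/- The function f : ℍ → ℍ given by f(x₀+ix₁+jx₂+kx₃) := x₁ − i·x₀ is (1,3)-regular on ℍ, but it is not slice-regular. -/
open Quaternion

noncomputable section

/-- The function `f(x₀+ix₁+jx₂+kx₃) = x₁ − i·x₀`. -/
def f7 : H → H := fun x => (x.imI : H) - x.re • qi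

/-- On `ℝ³_J` with `J ∈ S¹`, the function `f7` is the real-linear map
`(x₀, x₁, β) ↦ x₁ − x₀ i`. -/
theorem f7_psi {J : H} (hJ : J ∈ S1) :
    (fun v => f7 (psi J v)) =
      ⇑(((ContinuousLinearMap.fst ℝ ℝ ℝ).comp
          (ContinuousLinearMap.snd ℝ ℝ (ℝ × ℝ))).smulRight (1 : H) -
        (ContinuousLinearMap.fst ℝ ℝ (ℝ × ℝ)).smulRight qi) := by
  obtain ⟨h0, h1, -⟩ := hJ
  funext v
  ext <;> simp [f7, psi, h0, h1]

theorem qj_sq : qj ^ 2 = -1 := by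
  rw [sq]
  ext <;> simp

/-- On `ℝ + jℝ`, the function `f7` is the real-linear map `(α, β) ↦ −α i`. -/
theorem f7_slice_qj :
    (fun q : ℝ × ℝ => f7 ((q.1 : H) + q.2 • qj)) =
      ⇑(-(ContinuousLinearMap.fst ℝ ℝ ℝ).smulRight qi) := by
  funext q
  ext <;> simp [f7]

theorem regular13_f7 : Regular13 f7 Set.univ := by
  intro J hJ u _
  rw [f7_psi hJ]
  refine ⟨ContinuousLinearMap.differentiableAt _, ?_⟩
  rw [ContinuousLinearMap.fderiv]
  simp

theorem not_sliceRegularOn_f7 : ¬ SliceRegularOn f7 Set.univ := by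
  intro h
  have h2 := (h qj qj_sq 0 (Set.mem_univ _)).2
  rw [f7_slice_qj, ContinuousLinearMap.fderiv] at h2
  have h3 := congrArg (fun x : H => x.imI) h2
  simp at h3

/-- `f(x) = x₁ − i·x₀` is `(1,3)`-regular on `ℍ` but not slice-regular. -/
theorem stmt7 :
    Regular13 f7 Set.univ ∧ ¬ SliceRegularOn f7 Set.univ := by
  exact ⟨regular13_f7, not_sliceRegularOn_f7⟩
end
end

section
/- For every domain Ω in ℍ, the set of (1,3)-regular functions Ω → ℍ is distinct from the set of left Fueter-regular functions Ω → ℍ, and is also distinct from the set of slice-regular functions Ω → ℍ. -/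
open Quaternion

noncomputable section

/-- The parametrization `psi J` is real-linear. -/
def psiCLM (J : H) : ℝ × ℝ × ℝ →L[ℝ] H :=
  LinearMap.toContinuousLinearMap
    { toFun := psi J
      map_add' := fun u v => by
        ext <;> simp [psi] <;> ring
      map_smul' := fun c u => by
        ext <;> simp [psi] <;> ring }

/-- A real-linear map is `J`-monogenic at a point only if its linear part satisfies the
Cauchy–Riemann equation. -/
theorem JMonogenicOn.clm_eq_zero {J : H} {Ω : Set H} {L : H →L[ℝ] H}
    (h : JMonogenicOn J L Ω) {u : ℝ × ℝ × ℝ} (hu : psi J u ∈ Ω) :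
    L 1 + qi * L qi + J * L J = 0 := by
  have hd : fderiv ℝ (fun v => L (psi J v)) u = L.comp (psiCLM J) :=
    (L.comp (psiCLM J)).fderiv
  have h' := (h u hu).2
  have h1 : psiCLM J (1, 0, 0) = 1 := by
    change psi J (1, 0, 0) = 1
    simp [psi]
  have h2 : psiCLM J (0, 1, 0) = qi := by
    change psi J (0, 1, 0) = qi
    simp [psi]
  have h3 : psiCLM J (0, 0, 1) = J := by
    change psi J (0, 0, 1) = J
    simp [psi]
  simpa only [hd, ContinuousLinearMap.comp_apply, h1, h2, h3] using h'

/-- The hyperplanes `ℝ³_J` cover `ℍ`. -/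
theorem exists_psi_eq (x : H) : ∃ J ∈ S1, ∃ u, psi J u = x := by
  by_cases h : x.imJ ^ 2 + x.imK ^ 2 = 0
  · have hJ : x.imJ = 0 := by nlinarith [sq_nonneg x.imJ, sq_nonneg x.imK]
    have hK : x.imK = 0 := by nlinarith [sq_nonneg x.imJ, sq_nonneg x.imK]
    refine ⟨qj, ⟨rfl, rfl, by simp⟩, (x.re, x.imI, 0), ?_⟩
    ext <;> simp [psi, hJ, hK]
  · have hpos : 0 < x.imJ ^ 2 + x.imK ^ 2 := lt_of_le_of_ne (by positivity) (Ne.symm h)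
    set r := Real.sqrt (x.imJ ^ 2 + x.imK ^ 2) with hr
    have hr0 : r ≠ 0 := (Real.sqrt_pos.mpr hpos).ne'
    have hr2 : r ^ 2 = x.imJ ^ 2 + x.imK ^ 2 := Real.sq_sqrt hpos.le
    refine ⟨(x.imJ / r) • qj + (x.imK / r) • qk, ⟨by simp, by simp, ?_⟩, (x.re, x.imI, r), ?_⟩
    · have hsum : (x.imJ / r) ^ 2 + (x.imK / r) ^ 2 = 1 := by
        rw [div_pow, div_pow, ← add_div, ← hr2, div_self (pow_ne_zero 2 hr0)]
      simpa using hsum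
    · ext <;> simp [psi] <;> field_simp

/-- The real-linear map `x ↦ x₂ - i x₃`. -/
def subMulCLM : H →L[ℝ] H :=
  LinearMap.toContinuousLinearMap
    { toFun := fun x => (x.imJ : H) - x.imK • qi
      map_add' := fun x y => by
        ext <;> simp <;> ring
      map_smul' := fun c x => by
        ext <;> simp }

theorem subMulCLM_apply (x : H) : subMulCLM x = (x.imJ : H) - x.imK • qi := rfl

theorem fueterRegularOn_subMulCLM (Ω : Set H) : FueterRegularOn subMulCLM Ω := by
  refine ⟨subMulCLM.contDiff.contDiffOn, fun x _ => ?_⟩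
  rw [subMulCLM.fderiv]
  simp only [subMulCLM_apply]
  ext <;> simp

theorem sliceRegularOn_id (Ω : Set H) : SliceRegularOn (ContinuousLinearMap.id ℝ H) Ω := by
  intro I hI p _
  let L : ℝ × ℝ →L[ℝ] H :=
    (ContinuousLinearMap.fst ℝ ℝ ℝ).smulRight (1 : H) +
      (ContinuousLinearMap.snd ℝ ℝ ℝ).smulRight I
  have hL : (fun q : ℝ × ℝ => ContinuousLinearMap.id ℝ H ((q.1 : H) + q.2 • I)) = L := by
    funext q
    ext <;> simp [L]
  rw [hL, L.fderiv]
  refine ⟨L.differentiableAt, ?_⟩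
  simp [L, ← sq, hI]

theorem not_regular13_subMulCLM {Ω : Set H} (hΩ : Ω.Nonempty) : ¬ Regular13 subMulCLM Ω := by
  obtain ⟨x, hx⟩ := hΩ
  obtain ⟨J, hJ, u, rfl⟩ := exists_psi_eq x
  intro h
  have key := (h J hJ).clm_eq_zero hx
  obtain ⟨h0, h1, h2⟩ := hJ
  have eJ := congrArg QuaternionAlgebra.imJ key
  have eK := congrArg QuaternionAlgebra.imK key
  simp [subMulCLM_apply, h0, h1] at eJ eK
  have hprod : J.imJ * J.imK = 0 := by linarith
  rcases mul_eq_zero.mp hprod with h | h <;> simp_all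

theorem not_regular13_id {Ω : Set H} (hΩ : Ω.Nonempty) :
    ¬ Regular13 (ContinuousLinearMap.id ℝ H) Ω := by
  obtain ⟨x, hx⟩ := hΩ
  obtain ⟨J, hJ, u, rfl⟩ := exists_psi_eq x
  intro h
  have key := (h J hJ).clm_eq_zero hx
  obtain ⟨h0, h1, h2⟩ := hJ
  have e := congrArg QuaternionAlgebra.re key
  simp [h0, h1] at e
  nlinarith

/-- on every domain `Ω ⊆ ℍ` (nonempty, connected, open), the class of
`(1,3)`-regular functions differs from the class of left Fueter-regular functions and
from the class of slice-regular functions. -/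
theorem stmt8 (Ω : Set H) (hΩ_open : IsOpen Ω) (hΩ_conn : IsConnected Ω) :
    {f : H → H | Regular13 f Ω} ≠ {f : H → H | FueterRegularOn f Ω} ∧
    {f : H → H | Regular13 f Ω} ≠ {f : H → H | SliceRegularOn f Ω} := by
  exact ⟨fun h => not_regular13_subMulCLM hΩ_conn.nonempty
      (h.symm.subset (fueterRegularOn_subMulCLM Ω)),
    fun h => not_regular13_id hΩ_conn.nonempty (h.symm.subset (sliceRegularOn_id Ω))⟩
end
end

section
/- For every 𝐤 = (k₁,k₂) ∈ ℕ² and every J ∈ S¹, the restriction of 𝒯_𝐤 to ℝ³_J equals 𝒫^J_𝐤·J^{k₂}: that is, 𝒯_𝐤(x₀+ix₁+βJ) = 𝒫^J_𝐤(x₀+ix₁+βJ)·J^{k₂} for all (x₀,x₁,β) ∈ ℝ³. Consequently, 𝒯_𝐤 maps ℝ³_J into ℝ³_J when k₂ is even, and maps ℝ³_J into ℝ+jℝ+kℝ when k₂ is odd. -/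
open Quaternion

noncomputable section

/-- `x₁ − (−1)^{k₂}·i·x₀`, as a function of `x ∈ ℍ`. -/
def zA (k2 : ℕ) (x : H) : H := (x.imI : H) - ((-1 : ℝ) ^ k2 * x.re) • qi

/-- `x₀ + j x₂ + k x₃`, as a function of `x ∈ ℍ`. -/
def zB (x : H) : H := (x.re : H) + x.imJ • qj + x.imK • qk

/-- The polynomials `𝒯_𝐤 : ℍ → ℍ`: `𝒯_{(0,0)} ≡ 1` and, for `𝐤 ≠ (0,0)`,
`|𝐤|·𝒯_𝐤(x) = k₁·𝒯_{(k₁−1,k₂)}(x)·(x₁−(−1)^{k₂}ix₀) + k₂·𝒯_{(k₁,k₂−1)}(x)·(x₀+jx₂+kx₃)`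
(terms with a negative index are zero). -/
def T : ℕ → ℕ → H → H
  | 0, 0, _ => 1
  | k1 + 1, 0, x =>
      ((k1 + 1 : ℝ))⁻¹ • ((k1 + 1 : ℝ) • (T k1 0 x * zA 0 x))
  | 0, k2 + 1, x =>
      ((k2 + 1 : ℝ))⁻¹ • ((k2 + 1 : ℝ) • (T 0 k2 x * zB x))
  | k1 + 1, k2 + 1, x =>
      ((k1 + 1 + (k2 + 1) : ℝ))⁻¹ •
        ((k1 + 1 : ℝ) • (T k1 (k2 + 1) x * zA (k2 + 1) x)
          + (k2 + 1 : ℝ) • (T (k1 + 1) k2 x * zB x))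
  termination_by k1 k2 => k1 + k2

/-- The Fueter variable `ζ₁ = x₁ − i·x₀` in the coordinates `(x₀,x₁,β)` of `ℝ³_J`. -/
def zeta1 (u : ℝ × ℝ × ℝ) : H := (u.2.1 : H) - u.1 • qi

/-- The Fueter variable `ζ_{2,J} = β − J·x₀` in the coordinates `(x₀,x₁,β)`. -/
def zeta2 (J : H) (u : ℝ × ℝ × ℝ) : H := (u.2.2 : H) - u.1 • J

/-- The Fueter polynomials `𝒫^J_𝐤` on `ℝ³_J` (in the coordinates `(x₀,x₁,β)`):
`𝒫^J_{(0,0)} ≡ 1` and `|𝐤|·𝒫^J_𝐤 = k₁·𝒫^J_{(k₁−1,k₂)}·ζ₁ + k₂·𝒫^J_{(k₁,k₂−1)}·ζ_{2,J}`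
(terms with a negative index are zero). -/
def P (J : H) : ℕ → ℕ → (ℝ × ℝ × ℝ) → H
  | 0, 0, _ => 1
  | k1 + 1, 0, u =>
      ((k1 + 1 : ℝ))⁻¹ • ((k1 + 1 : ℝ) • (P J k1 0 u * zeta1 u))
  | 0, k2 + 1, u =>
      ((k2 + 1 : ℝ))⁻¹ • ((k2 + 1 : ℝ) • (P J 0 k2 u * zeta2 J u))
  | k1 + 1, k2 + 1, u =>
      ((k1 + 1 + (k2 + 1) : ℝ))⁻¹ •
        ((k1 + 1 : ℝ) • (P J k1 (k2 + 1) u * zeta1 u)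
          + (k2 + 1 : ℝ) • (P J (k1 + 1) k2 u * zeta2 J u))
  termination_by k1 k2 => k1 + k2

/-- The sum of all words with `m` letters `a` and `n` letters `b`. -/
def wordSum {R : Type*} [Ring R] (a b : R) : ℕ → ℕ → R
  | 0, 0 => 1
  | m + 1, 0 => wordSum a b m 0 * a
  | 0, n + 1 => wordSum a b 0 n * b
  | m + 1, n + 1 => wordSum a b m (n + 1) * a + wordSum a b (m + 1) n * b
  termination_by m n => m + n

theorem wordSum_succ_zero {R : Type*} [Ring R] (a b : R) (m : ℕ) :
    wordSum a b (m + 1) 0 = a * wordSum a b m 0 := by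
  induction m with
  | zero => simp [wordSum]
  | succ m ih =>
    rw [wordSum, ih, mul_assoc, ← wordSum, ih]

theorem wordSum_zero_succ {R : Type*} [Ring R] (a b : R) (n : ℕ) :
    wordSum a b 0 (n + 1) = b * wordSum a b 0 n := by
  induction n with
  | zero => simp [wordSum]
  | succ n ih =>
    rw [wordSum, ih, mul_assoc, ← wordSum, ih]

theorem wordSum_succ_succ {R : Type*} [Ring R] (a b : R) : ∀ m n : ℕ,
    wordSum a b (m + 1) (n + 1) = a * wordSum a b m (n + 1) + b * wordSum a b (m + 1) n
  | 0, 0 => by simp [wordSum, add_comm]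
  | 0, n + 1 => by
    linear_combination (norm := noncomm_ring) wordSum.eq_4 a b 0 (n + 1) +
      wordSum_zero_succ a b (n + 1) * a + wordSum_succ_succ a b 0 n * b -
      a * wordSum.eq_3 a b (n + 1) - b * wordSum.eq_4 a b 0 n
  | m + 1, 0 => by
    linear_combination (norm := noncomm_ring) wordSum.eq_4 a b (m + 1) 0 +
      wordSum_succ_succ a b m 0 * a + wordSum_succ_zero a b (m + 1) * b -
      a * wordSum.eq_4 a b m 0 - b * wordSum.eq_2 a b (m + 1)
  | m + 1, n + 1 => by
    linear_combination (norm := noncomm_ring) wordSum.eq_4 a b (m + 1) (n + 1) +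
      wordSum_succ_succ a b m (n + 1) * a + wordSum_succ_succ a b (m + 1) n * b -
      a * wordSum.eq_4 a b m (n + 1) - b * wordSum.eq_4 a b (m + 1) n
  termination_by m n => m + n

theorem mul_star_wordSum {R : Type*} [Ring R] [StarRing R] {a b c : R}
    (ha : c * star a = a * c) (hb : c * star b = b * c) :
    ∀ m n : ℕ, c * star (wordSum a b m n) = wordSum a b m n * c
  | 0, 0 => by simp [wordSum]
  | m + 1, 0 => by
    rw [wordSum_succ_zero, mul_assoc, ← mul_star_wordSum ha hb m 0, ← mul_assoc, ← ha,
      ← wordSum_succ_zero, wordSum, star_mul, mul_assoc]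
  | 0, n + 1 => by
    rw [wordSum_zero_succ, mul_assoc, ← mul_star_wordSum ha hb 0 n, ← mul_assoc, ← hb,
      ← wordSum_zero_succ, wordSum, star_mul, mul_assoc]
  | m + 1, n + 1 => by
    rw [wordSum_succ_succ, add_mul, mul_assoc, mul_assoc, ← mul_star_wordSum ha hb m (n + 1),
      ← mul_star_wordSum ha hb (m + 1) n, ← mul_assoc, ← mul_assoc, ← ha, ← hb,
      ← wordSum_succ_succ, wordSum, star_add, star_mul, star_mul, mul_add, mul_assoc, mul_assoc]
  termination_by m n => m + n

theorem P_eq_smul_wordSum (J : H) (u : ℝ × ℝ × ℝ) : ∀ m n : ℕ,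
    P J m n u = ((m.factorial * n.factorial : ℝ) / ((m + n).factorial : ℝ)) •
      wordSum (zeta1 u) (zeta2 J u) m n
  | 0, 0 => by simp [P, wordSum]
  | m + 1, 0 => by
    have h : (m + 1 : ℝ) ≠ 0 := by positivity
    have hf : ∀ k : ℕ, (k.factorial : ℝ) ≠ 0 := fun k => by positivity
    rw [P, wordSum, P_eq_smul_wordSum J u m 0, inv_smul_smul₀ h]
    simp [hf]
  | 0, n + 1 => by
    have h : (n + 1 : ℝ) ≠ 0 := by positivity
    have hf : ∀ k : ℕ, (k.factorial : ℝ) ≠ 0 := fun k => by positivity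
    rw [P, wordSum, P_eq_smul_wordSum J u 0 n, inv_smul_smul₀ h]
    simp [hf]
  | m + 1, n + 1 => by
    have hf : ∀ k : ℕ, (k.factorial : ℝ) ≠ 0 := fun k => by positivity
    have h : (m + 1 + (n + 1) : ℝ) ≠ 0 := by positivity
    have hN : ((m + 1 + (n + 1)).factorial : ℝ) =
        (m + 1 + (n + 1) : ℝ) * ((m + n + 1).factorial : ℝ) := by
      rw [show m + 1 + (n + 1) = (m + n + 1) + 1 by ring, Nat.factorial_succ]
      push_cast
      ring
    rw [P, wordSum, P_eq_smul_wordSum J u m (n + 1), P_eq_smul_wordSum J u (m + 1) n, hN,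
      show m + (n + 1) = m + n + 1 by ring, show m + 1 + n = m + n + 1 by ring,
      smul_mul_assoc, smul_mul_assoc, smul_add, smul_add, smul_smul, smul_smul, smul_smul,
      smul_smul, Nat.factorial_succ m, Nat.factorial_succ n]
    have := hf (m + n + 1)
    push_cast
    congr 2 <;> field_simp
  termination_by m n => m + n

theorem mem_hplane_iff {J : H} (hJ : J ∈ S1) (x : H) :
    x ∈ hplane J ↔ J.imJ * x.imK = J.imK * x.imJ := by
  obtain ⟨h0, h1, h2⟩ := hJ
  constructor
  · rintro ⟨u, rfl⟩
    simp [psi]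
    ring
  · intro h
    refine ⟨(x.re, x.imI, J.imJ * x.imJ + J.imK * x.imK), ?_⟩
    ext
    · simp [psi, h0]
    · simp [psi, h1]
    · simp [psi]
      linear_combination x.imJ * h2 + J.imK * h
    · simp [psi]
      linear_combination x.imK * h2 - J.imJ * h

theorem S1.mul_self {J : H} (hJ : J ∈ S1) : J * J = -1 := by
  obtain ⟨h0, h1, h2⟩ := hJ
  ext <;> simp [h0, h1] <;> linarith

theorem P_mem_hplane {J : H} (hJ : J ∈ S1) (m n : ℕ) (u : ℝ × ℝ × ℝ) :
    P J m n u ∈ hplane J := by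
  obtain ⟨h0, h1, h2⟩ := id hJ
  have key := mul_star_wordSum (a := zeta1 u) (b := zeta2 J u) (c := qi * J)
    (by ext <;> simp [zeta1, h0, h1] <;> ring)
    (by ext <;> simp [zeta2, h0, h1] <;> ring) m n
  have hre := congrArg QuaternionAlgebra.re key
  simp [h0, h1] at hre
  rw [P_eq_smul_wordSum, mem_hplane_iff hJ]
  simp
  linear_combination ((m.factorial * n.factorial : ℝ) / ((m + n).factorial : ℝ)) * hre / 2

theorem pow_mul_zA {J : H} (hJ : J ∈ S1) (n : ℕ) (u : ℝ × ℝ × ℝ) :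
    J ^ n * zA n (psi J u) = zeta1 u * J ^ n := by
  obtain ⟨h0, h1, h2⟩ := hJ
  have hqi : J * qi = -(qi * J) := by
    ext <;> simp [h0, h1]
  have hpow : J ^ n * qi = (-1 : ℝ) ^ n • (qi * J ^ n) := by
    induction n with
    | zero => simp
    | succ n ih =>
      rw [pow_succ, mul_assoc, hqi, mul_neg, ← mul_assoc, ih, pow_succ (-1 : ℝ)]
      simp [mul_assoc]
  have hre : (psi J u).re = u.1 := by simp [psi, h0]
  have him : (psi J u).imI = u.2.1 := by simp [psi, h1]
  rw [zA, zeta1, hre, him, mul_sub, sub_mul, mul_smul_comm, hpow, smul_smul, smul_mul_assoc,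
    Quaternion.coe_commutes]
  congr 2
  rw [mul_right_comm, ← mul_pow]
  simp

theorem pow_mul_zB {J : H} (hJ : J ∈ S1) (n : ℕ) (u : ℝ × ℝ × ℝ) :
    J ^ n * zB (psi J u) = zeta2 J u * J ^ (n + 1) := by
  have hz : zB (psi J u) = zeta2 J u * J := by
    obtain ⟨h0, h1, h2⟩ := hJ
    ext <;> simp [zB, zeta2, psi, h0, h1]
    · linear_combination (-u.1) * h2
    · ring
  have hc : Commute J (zeta2 J u) := by
    rw [zeta2]
    exact (Quaternion.coe_commute _ _).symm.sub_right ((Commute.refl J).smul_right _)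
  rw [hz, ← mul_assoc, (hc.pow_left n).eq, mul_assoc, pow_succ]

theorem T_psi {J : H} (hJ : J ∈ S1) (u : ℝ × ℝ × ℝ) : ∀ m n : ℕ,
    T m n (psi J u) = P J m n u * J ^ n
  | 0, 0 => by simp [T, P]
  | m + 1, 0 => by
    rw [T, P, T_psi hJ u m 0, mul_assoc, pow_mul_zA hJ]
    simp only [smul_mul_assoc, mul_assoc]
  | 0, n + 1 => by
    rw [T, P, T_psi hJ u 0 n, mul_assoc, pow_mul_zB hJ]
    simp only [smul_mul_assoc, mul_assoc]
  | m + 1, n + 1 => by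
    rw [T, P, T_psi hJ u m (n + 1), T_psi hJ u (m + 1) n, mul_assoc, mul_assoc, pow_mul_zA hJ,
      pow_mul_zB hJ]
    simp only [smul_mul_assoc, mul_assoc, add_mul]
  termination_by m n => m + n

/-- for every `𝐤 = (k₁,k₂) ∈ ℕ²` and `J ∈ S¹`, the restriction of `𝒯_𝐤`
to `ℝ³_J` equals `𝒫^J_𝐤·J^{k₂}`; consequently `𝒯_𝐤` maps `ℝ³_J` into `ℝ³_J` when `k₂`
is even, and into `ℝ + jℝ + kℝ` when `k₂` is odd. -/
theorem stmt9 (k1 k2 : ℕ) (J : H) (hJ : J ∈ S1) :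
    (∀ u : ℝ × ℝ × ℝ, T k1 k2 (psi J u) = P J k1 k2 u * J ^ k2) ∧
    (Even k2 → ∀ x ∈ hplane J, T k1 k2 x ∈ hplane J) ∧
    (Odd k2 → ∀ x ∈ hplane J, (T k1 k2 x).imI = 0) := by
  refine ⟨fun u => T_psi hJ u k1 k2, ?_, ?_⟩
  · rintro ⟨r, rfl⟩ _ ⟨u, rfl⟩
    have h := (mem_hplane_iff hJ _).1 (P_mem_hplane hJ k1 (r + r) u)
    rw [T_psi hJ, pow_add, ← (Commute.refl J).mul_pow, S1.mul_self hJ, mem_hplane_iff hJ]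
    rcases neg_one_pow_eq_or H r with hr | hr
    · simpa [hr] using h
    · simpa [hr] using h
  · rintro ⟨r, rfl⟩ _ ⟨u, rfl⟩
    have h := (mem_hplane_iff hJ _).1 (P_mem_hplane hJ k1 (2 * r + 1) u)
    obtain ⟨h0, h1, -⟩ := id hJ
    rw [T_psi hJ, pow_succ, pow_mul, sq, S1.mul_self hJ]
    rcases neg_one_pow_eq_or H r with hr | hr
    · simp [hr, h0, h1]
      linarith
    · simp [hr, h0, h1]
      linarith
end
end

section
/- For every 𝐤 = (k₁,k₂) ∈ ℕ² there exist polynomial maps A_𝐤, B_𝐤 : ℂ×ℝ → ℂ such that 𝒯_𝐤(x) = A_𝐤(x₀+ix₁, x₂²+x₃²) + (jx₂+kx₃)·B_𝐤(x₀+ix₁, x₂²+x₃²) for all x = x₀+ix₁+jx₂+kx₃ ∈ ℍ, and such that the maps (x₀,x₁,β) ↦ A_𝐤(x₀+ix₁, β²) and (x₀,x₁,β) ↦ β·B_𝐤(x₀+ix₁, β²) are homogeneous of degree |𝐤| = k₁+k₂. -/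
open Quaternion

noncomputable section

/-- The embedding `ℂ → ℍ`, `a + bi ↦ a + bi`. -/
def embedC (z : ℂ) : H := ⟨z.re, z.im, 0, 0⟩

/-- `F : ℂ × ℝ → ℂ` is a (real) polynomial map: both real components of `F` are given
by real polynomials in the three real variables `(Re z, Im z, t)`. -/
def IsPolyMapCC (F : ℂ × ℝ → ℂ) : Prop :=
  ∃ pr pi : MvPolynomial (Fin 3) ℝ,
    ∀ z : ℂ, ∀ t : ℝ,
      F (z, t) = Complex.mk (MvPolynomial.eval ![z.re, z.im, t] pr)
        (MvPolynomial.eval ![z.re, z.im, t] pi)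

@[simp] theorem embedC_re (z : ℂ) : (embedC z).re = z.re := rfl
@[simp] theorem embedC_imI (z : ℂ) : (embedC z).imI = z.im := rfl
@[simp] theorem embedC_imJ (z : ℂ) : (embedC z).imJ = 0 := rfl
@[simp] theorem embedC_imK (z : ℂ) : (embedC z).imK = 0 := rfl

namespace IsPolyMapCC

theorem const (c : ℂ) : IsPolyMapCC (fun _ => c) :=
  ⟨MvPolynomial.C c.re, MvPolynomial.C c.im, fun z t => by simp⟩

theorem re : IsPolyMapCC (fun p => (p.1.re : ℂ)) :=
  ⟨MvPolynomial.X 0, 0, fun z t => by apply Complex.ext <;> simp⟩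

theorem im : IsPolyMapCC (fun p => (p.1.im : ℂ)) :=
  ⟨MvPolynomial.X 1, 0, fun z t => by apply Complex.ext <;> simp⟩

theorem snd : IsPolyMapCC (fun p => (p.2 : ℂ)) :=
  ⟨MvPolynomial.X 2, 0, fun z t => by apply Complex.ext <;> simp⟩

theorem add {F G : ℂ × ℝ → ℂ} (hF : IsPolyMapCC F) (hG : IsPolyMapCC G) :
    IsPolyMapCC (fun p => F p + G p) := by
  obtain ⟨a, b, hF⟩ := hF
  obtain ⟨c, d, hG⟩ := hG
  refine ⟨a + c, b + d, fun z t => ?_⟩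
  apply Complex.ext <;> simp [hF, hG]

theorem mul {F G : ℂ × ℝ → ℂ} (hF : IsPolyMapCC F) (hG : IsPolyMapCC G) :
    IsPolyMapCC (fun p => F p * G p) := by
  obtain ⟨a, b, hF⟩ := hF
  obtain ⟨c, d, hG⟩ := hG
  refine ⟨a * c - b * d, a * d + b * c, fun z t => ?_⟩
  apply Complex.ext <;> simp [hF, hG]

theorem sub {F G : ℂ × ℝ → ℂ} (hF : IsPolyMapCC F) (hG : IsPolyMapCC G) :
    IsPolyMapCC (fun p => F p - G p) := by
  simpa [sub_eq_add_neg] using hF.add ((const (-1)).mul hG)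

theorem conj {F : ℂ × ℝ → ℂ} (hF : IsPolyMapCC F) :
    IsPolyMapCC (fun p => starRingEnd ℂ (F p)) := by
  obtain ⟨a, b, hF⟩ := hF
  refine ⟨a, -b, fun z t => ?_⟩
  apply Complex.ext <;> simp [hF]

end IsPolyMapCC

/-- `f(x) = A(x₀+ix₁, x₂²+x₃²) + (jx₂+kx₃)·B(x₀+ix₁, x₂²+x₃²)` with polynomial maps `A`, `B`
such that `A(x₀+ix₁, β²)` and `β·B(x₀+ix₁, β²)` are homogeneous of degree `n`. -/
def HasHomogeneousForm (n : ℕ) (f : H → H) : Prop :=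
  ∃ A B : ℂ × ℝ → ℂ,
    IsPolyMapCC A ∧ IsPolyMapCC B ∧
    (∀ x : H,
      f x =
        embedC (A (Complex.mk x.re x.imI, x.imJ ^ 2 + x.imK ^ 2)) +
          (x.imJ • qj + x.imK • qk) *
            embedC (B (Complex.mk x.re x.imI, x.imJ ^ 2 + x.imK ^ 2))) ∧
    (∀ r x0 x1 β : ℝ,
      A (Complex.mk (r * x0) (r * x1), (r * β) ^ 2)
        = (r : ℂ) ^ n * A (Complex.mk x0 x1, β ^ 2) ∧
      ((r * β : ℝ) : ℂ) * B (Complex.mk (r * x0) (r * x1), (r * β) ^ 2)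
        = (r : ℂ) ^ n * ((β : ℝ) : ℂ) * B (Complex.mk x0 x1, β ^ 2))

namespace HasHomogeneousForm

variable {n : ℕ} {f g : H → H}

theorem one : HasHomogeneousForm 0 (fun _ => 1) := by
  refine ⟨fun _ => 1, fun _ => 0, .const 1, .const 0, fun x => ?_, by simp⟩
  ext <;> simp

theorem add (hf : HasHomogeneousForm n f) (hg : HasHomogeneousForm n g) :
    HasHomogeneousForm n (fun x => f x + g x) := by
  obtain ⟨A, B, hA, hB, hrep, hhom⟩ := hf
  obtain ⟨C, D, hC, hD, hrep', hhom'⟩ := hg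
  refine ⟨_, _, hA.add hC, hB.add hD, fun x => ?_, fun r x0 x1 β => ⟨?_, ?_⟩⟩
  · simp only [hrep, hrep']
    ext <;> simp <;> ring
  · linear_combination (hhom r x0 x1 β).1 + (hhom' r x0 x1 β).1
  · linear_combination (hhom r x0 x1 β).2 + (hhom' r x0 x1 β).2

theorem smul (c : ℝ) (hf : HasHomogeneousForm n f) :
    HasHomogeneousForm n (fun x => c • f x) := by
  obtain ⟨A, B, hA, hB, hrep, hhom⟩ := hf
  refine ⟨_, _, (IsPolyMapCC.const c).mul hA, (IsPolyMapCC.const c).mul hB, fun x => ?_,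
    fun r x0 x1 β => ⟨?_, ?_⟩⟩
  · simp only [hrep]
    ext <;> simp <;> ring
  · linear_combination (c : ℂ) * (hhom r x0 x1 β).1
  · linear_combination (c : ℂ) * (hhom r x0 x1 β).2

theorem mul_zA (k : ℕ) (hf : HasHomogeneousForm n f) :
    HasHomogeneousForm (n + 1) (fun x => f x * zA k x) := by
  obtain ⟨A, B, hA, hB, hrep, hhom⟩ := hf
  have hc := IsPolyMapCC.im.sub
    ((IsPolyMapCC.const (((-1 : ℝ) ^ k : ℝ) * Complex.I)).mul IsPolyMapCC.re)
  refine ⟨_, _, hA.mul hc, hB.mul hc, fun x => ?_, fun r x0 x1 β => ⟨?_, ?_⟩⟩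
  · simp only [hrep, zA]
    generalize (-1 : ℝ) ^ k = s
    ext <;> simp <;> ring
  · have h := (hhom r x0 x1 β).1
    simp only [h]
    push_cast
    ring
  · have h := (hhom r x0 x1 β).2
    simp only [← mul_assoc, h]
    push_cast
    ring

theorem mul_zB (hf : HasHomogeneousForm n f) :
    HasHomogeneousForm (n + 1) (fun x => f x * zB x) := by
  obtain ⟨A, B, hA, hB, hrep, hhom⟩ := hf
  refine ⟨_, _, (IsPolyMapCC.re.mul hA).sub (IsPolyMapCC.snd.mul hB.conj),
    hA.conj.add (IsPolyMapCC.re.mul hB), fun x => ?_, fun r x0 x1 β => ?_⟩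
  · simp only [hrep, zB]
    ext <;> simp [pow_two] <;> ring
  · obtain ⟨h₁, h₂⟩ := hhom r x0 x1 β
    have h₁c := congrArg (starRingEnd ℂ) h₁
    have h₂c := congrArg (starRingEnd ℂ) h₂
    simp only [map_mul, map_pow, Complex.conj_ofReal] at h₁c h₂c
    push_cast at h₂ h₂c ⊢
    constructor
    · linear_combination (r * x0 : ℂ) * h₁ - (r * β : ℂ) * h₂c
    · linear_combination (r * β : ℂ) * h₁c + (r * x0 : ℂ) * h₂

end HasHomogeneousForm

theorem hasHomogeneousForm_T (k1 k2 : ℕ) : HasHomogeneousForm (k1 + k2) (T k1 k2) := by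
  induction k1 generalizing k2 with
  | zero =>
    induction k2 with
    | zero =>
      convert HasHomogeneousForm.one using 2
      simp [T]
    | succ k2 ih =>
      have h : HasHomogeneousForm (0 + (k2 + 1)) _ :=
        (ih.mul_zB.smul (k2 + 1 : ℝ)).smul (k2 + 1 : ℝ)⁻¹
      convert h using 2
      rw [T]
  | succ k1 ih₁ =>
    induction k2 with
    | zero =>
      convert (((ih₁ 0).mul_zA 0).smul (k1 + 1 : ℝ)).smul (k1 + 1 : ℝ)⁻¹ using 2
      rw [T]
    | succ k2 ih₂ =>
      have h₁ := ((ih₁ (k2 + 1)).mul_zA (k2 + 1)).smul (k1 + 1 : ℝ)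
      have h₂ := ih₂.mul_zB.smul (k2 + 1 : ℝ)
      rw [show k1 + (k2 + 1) + 1 = k1 + 1 + (k2 + 1) by ring] at h₁
      convert (h₁.add h₂).smul (k1 + 1 + (k2 + 1) : ℝ)⁻¹ using 2
      rw [T]

/-- for every `𝐤 = (k₁,k₂) ∈ ℕ²` there are polynomial maps
`A_𝐤, B_𝐤 : ℂ×ℝ → ℂ` with
`𝒯_𝐤(x) = A_𝐤(x₀+ix₁, x₂²+x₃²) + (jx₂+kx₃)·B_𝐤(x₀+ix₁, x₂²+x₃²)`,
such that `(x₀,x₁,β) ↦ A_𝐤(x₀+ix₁, β²)` and `(x₀,x₁,β) ↦ β·B_𝐤(x₀+ix₁, β²)` are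
homogeneous of degree `|𝐤| = k₁+k₂`. -/
theorem stmt13 (k1 k2 : ℕ) :
    ∃ A B : ℂ × ℝ → ℂ,
      IsPolyMapCC A ∧ IsPolyMapCC B ∧
      (∀ x : H,
        T k1 k2 x =
          embedC (A (Complex.mk x.re x.imI, x.imJ ^ 2 + x.imK ^ 2)) +
            (x.imJ • qj + x.imK • qk) *
              embedC (B (Complex.mk x.re x.imI, x.imJ ^ 2 + x.imK ^ 2))) ∧
      (∀ r x0 x1 β : ℝ,
        A (Complex.mk (r * x0) (r * x1), (r * β) ^ 2)
          = (r : ℂ) ^ (k1 + k2) * A (Complex.mk x0 x1, β ^ 2) ∧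
        ((r * β : ℝ) : ℂ) * B (Complex.mk (r * x0) (r * x1), (r * β) ^ 2)
          = (r : ℂ) ^ (k1 + k2) * ((β : ℝ) : ℂ) * B (Complex.mk x0 x1, β ^ 2)) :=
  hasHomogeneousForm_T k1 k2
end
end
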